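/- arXiv:2312.14971 — 4 statements merged into one kernel-verified Lean document; each statement's English description precedes it below -/
import Mathlib

section
/- Let I be a nonempty finite index set, and for each i ∈ I let l_i > 0, F_i > 0 and a_i > 0 be real numbers. If Q > 0 and the accumulated voltage drop satisfies ∑_{i∈I} l_i · F_i / a_i ≤ Q, then the material cost satisfies ∑_{i∈I} l_i · a_i ≥ (∑_{i∈I} l_i · √(F_i))² / Q. -/
open Finset

/-- lower bound on the material cost of a path under the
voltage-drop constraint. -/
theorem material_cost_lower_bound
    {I : Type*} [Fintype I] [Nonempty I]
    (l F a : I → ℝ) (Q : ℝ)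
    (hl : ∀ i, 0 < l i) (hF : ∀ i, 0 < F i) (ha : ∀ i, 0 < a i)
    (hQ : 0 < Q)
    (hdrop : ∑ i, l i * F i / a i ≤ Q) :
    (∑ i, l i * Real.sqrt (F i)) ^ 2 / Q ≤ ∑ i, l i * a i := by
  have hcost : ∀ i, 0 ≤ l i * a i := fun i => (mul_pos (hl i) (ha i)).le
  have hcs : (∑ i, l i * Real.sqrt (F i)) ^ 2 ≤ (∑ i, l i * a i) * ∑ i, l i * F i / a i := by
    refine sum_sq_le_sum_mul_sum_of_sq_le_mul univ (fun i _ => hcost i)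
      (fun i _ => (div_pos (mul_pos (hl i) (hF i)) (ha i)).le) (fun i _ => le_of_eq ?_)
    have hai := (ha i).ne'
    rw [mul_pow, Real.sq_sqrt (hF i).le]
    field_simp
  rw [div_le_iff₀ hQ]
  exact hcs.trans (mul_le_mul_of_nonneg_left hdrop (sum_nonneg fun i _ => hcost i))
end

section
/- Let I be a nonempty finite index set with l_i > 0, F_i > 0 for i ∈ I and let Q > 0. Then the set of achievable material costs { ∑_{i∈I} l_i · a_i : a_i > 0 for all i and ∑_{i∈I} l_i · F_i / a_i ≤ Q } has least element (∑_{i∈I} l_i · √(F_i))² / Q, and this minimum is attained by the capacities a_i* = √(F_i) · (∑_{j∈I} l_j · √(F_j)) / Q, which satisfy the voltage-drop constraint with equality. -/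
open Finset

/-- the set of achievable material costs has least element
`(∑ i, l i * √(F i))² / Q`, attained by the capacities
`a* i = √(F i) · (∑ j, l j · √(F j)) / Q`, which satisfy the voltage-drop
constraint with equality. -/
theorem material_cost_least_element
    {I : Type*} [Fintype I] [Nonempty I]
    (l F : I → ℝ) (Q : ℝ)
    (hl : ∀ i, 0 < l i) (hF : ∀ i, 0 < F i) (hQ : 0 < Q) :
    IsLeast
      {c : ℝ | ∃ a : I → ℝ, (∀ i, 0 < a i) ∧
        (∑ i, l i * F i / a i) ≤ Q ∧ c = ∑ i, l i * a i}
      ((∑ i, l i * Real.sqrt (F i)) ^ 2 / Q) ∧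
    (∀ i, 0 < Real.sqrt (F i) * (∑ j, l j * Real.sqrt (F j)) / Q) ∧
    (∑ i, l i * (Real.sqrt (F i) * (∑ j, l j * Real.sqrt (F j)) / Q))
      = (∑ i, l i * Real.sqrt (F i)) ^ 2 / Q ∧
    (∑ i, l i * F i / (Real.sqrt (F i) * (∑ j, l j * Real.sqrt (F j)) / Q)) = Q := by
  set S := ∑ j, l j * Real.sqrt (F j)
  have hs : ∀ i, 0 < Real.sqrt (F i) := fun i => Real.sqrt_pos.2 (hF i)
  have hSpos : 0 < S :=
    Finset.sum_pos (fun i _ => mul_pos (hl i) (hs i)) Finset.univ_nonempty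
  have hpos : ∀ i, 0 < Real.sqrt (F i) * S / Q := fun i =>
    div_pos (mul_pos (hs i) hSpos) hQ
  have hcost : ∑ i, l i * (Real.sqrt (F i) * S / Q) = S ^ 2 / Q := by
    calc ∑ i, l i * (Real.sqrt (F i) * S / Q)
        = ∑ i, l i * Real.sqrt (F i) * (S / Q) :=
          Finset.sum_congr rfl fun i _ => by ring
      _ = S * (S / Q) := by rw [← Finset.sum_mul]
      _ = S ^ 2 / Q := by ring
  have hdrop : ∑ i, l i * F i / (Real.sqrt (F i) * S / Q) = Q := by
    calc ∑ i, l i * F i / (Real.sqrt (F i) * S / Q)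
        = ∑ i, l i * Real.sqrt (F i) * (Q / S) := by
          refine Finset.sum_congr rfl fun i _ => ?_
          have hsi := (hs i).ne'
          nth_rewrite 1 [← Real.mul_self_sqrt (hF i).le]
          field_simp
      _ = S * (Q / S) := by rw [← Finset.sum_mul]
      _ = Q := mul_div_cancel₀ Q hSpos.ne'
  refine ⟨⟨⟨_, hpos, hdrop.le, hcost.symm⟩, ?_⟩, hpos, hcost, hdrop⟩
  rintro c ⟨a, ha, haQ, rfl⟩
  rw [div_le_iff₀ hQ]
  have hla : ∀ i, 0 ≤ l i * a i := fun i => (mul_pos (hl i) (ha i)).le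
  calc S ^ 2 ≤ (∑ i, l i * a i) * ∑ i, l i * F i / a i := by
        refine Finset.sum_sq_le_sum_mul_sum_of_sq_le_mul _ (fun i _ => hla i)
          (fun i _ => (div_pos (mul_pos (hl i) (hF i)) (ha i)).le) fun i _ => le_of_eq ?_
        have hai := (ha i).ne'
        rw [mul_pow, Real.sq_sqrt (hF i).le]
        field_simp
    _ ≤ (∑ i, l i * a i) * Q :=
        mul_le_mul_of_nonneg_left haQ (Finset.sum_nonneg fun i _ => hla i)
end

section
/- (Line capacity ratios.) Let I be a nonempty finite index set with l_i > 0, F_i > 0 for i ∈ I and Q > 0. Suppose the capacities a_i > 0 satisfy ∑_{i∈I} l_i · F_i / a_i ≤ Q and attain the minimum possible material cost, i.e. ∑_{i∈I} l_i · a_i = (∑_{i∈I} l_i · √(F_i))² / Q. Then for every pair of edges i, j ∈ I the cost-minimizing capacities fulfill a_i / a_j = √(F_i / F_j), equivalently a_i² · F_j = a_j² · F_i. -/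
open Finset

/-- A capacity vector that meets the voltage-drop bound `Q` at the minimum cost is proportional
to the square roots of the flows. -/
lemma capacity_eq_mul_sqrt_of_cost_eq
    {I : Type*} [Fintype I] (l F a : I → ℝ) (Q : ℝ)
    (hl : ∀ i, 0 < l i) (hF : ∀ i, 0 ≤ F i) (ha : ∀ i, 0 < a i) (hQ : 0 < Q)
    (hdrop : ∑ i, l i * F i / a i ≤ Q)
    (hopt : ∑ i, l i * a i = (∑ i, l i * Real.sqrt (F i)) ^ 2 / Q) (i : I) :
    a i = (∑ k, l k * Real.sqrt (F k)) / Q * Real.sqrt (F i) := by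
  set S := ∑ k, l k * Real.sqrt (F k) with hS
  set t := S / Q with ht
  have hnonneg : ∀ k ∈ univ, 0 ≤ l k / a k * (a k - t * Real.sqrt (F k)) ^ 2 := fun k _ =>
    mul_nonneg (div_pos (hl k) (ha k)).le (sq_nonneg _)
  have hexpand : ∑ k, l k / a k * (a k - t * Real.sqrt (F k)) ^ 2
      = ∑ k, l k * a k - 2 * t * S + t ^ 2 * ∑ k, l k * F k / a k := by
    rw [hS, mul_sum, mul_sum, ← sum_sub_distrib, ← sum_add_distrib]
    refine sum_congr rfl fun k _ => ?_
    have hk := (ha k).ne'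
    have hsq := Real.sq_sqrt (hF k)
    field_simp
    linear_combination l k * t ^ 2 * hsq
  have hle : ∑ k, l k / a k * (a k - t * Real.sqrt (F k)) ^ 2 ≤ 0 := by
    rw [hexpand, hopt]
    have hbound := mul_le_mul_of_nonneg_left hdrop (sq_nonneg t)
    have hcancel : S ^ 2 / Q - 2 * t * S + t ^ 2 * Q = 0 := by
      rw [ht]
      field_simp
      ring
    linarith
  have hzero := (sum_eq_zero_iff_of_nonneg hnonneg).1
    (le_antisymm hle (sum_nonneg hnonneg)) i (mem_univ i)
  have hsq := (mul_eq_zero.1 hzero).resolve_left (div_pos (hl i) (ha i)).ne'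
  exact sub_eq_zero.1 (pow_eq_zero_iff two_ne_zero |>.1 hsq)

/-- Line capacity ratios, Proposition 1: cost-minimizing
capacities along a path satisfy `a i / a j = √(F i / F j)`, equivalently
`a i ² · F j = a j ² · F i`. -/
theorem line_capacity_ratios
    {I : Type*} [Fintype I] [Nonempty I]
    (l F a : I → ℝ) (Q : ℝ)
    (hl : ∀ i, 0 < l i) (hF : ∀ i, 0 < F i) (ha : ∀ i, 0 < a i)
    (hQ : 0 < Q)
    (hdrop : ∑ i, l i * F i / a i ≤ Q)
    (hopt : ∑ i, l i * a i = (∑ i, l i * Real.sqrt (F i)) ^ 2 / Q) :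
    ∀ i j : I, a i / a j = Real.sqrt (F i / F j) ∧ a i ^ 2 * F j = a j ^ 2 * F i := by
  intro i j
  have hprop := capacity_eq_mul_sqrt_of_cost_eq l F a Q hl (fun k => (hF k).le) ha hQ hdrop hopt
  set t := (∑ k, l k * Real.sqrt (F k)) / Q
  have ht : t ≠ 0 := fun h => (ha i).ne' (by rw [hprop i, h, zero_mul])
  constructor
  · rw [hprop i, hprop j, Real.sqrt_div (hF i).le, mul_div_mul_left _ _ ht]
  · rw [hprop i, hprop j, mul_pow, mul_pow, Real.sq_sqrt (hF i).le, Real.sq_sqrt (hF j).le]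
    ring
end

section
/- Let I be a nonempty finite index set with l_i > 0, F_i > 0 for i ∈ I and Q > 0. If the capacities a_i > 0 satisfy ∑_{i∈I} l_i · F_i / a_i ≤ Q and attain the minimum material cost (∑_{i∈I} l_i · √(F_i))² / Q, then they are uniquely determined: a_i = √(F_i) · (∑_{j∈I} l_j · √(F_j)) / Q for every i ∈ I. -/
open Finset

/-- the cost-minimizing capacities along a path are uniquely
determined as `a i = √(F i) · (∑ j, l j · √(F j)) / Q`. -/
theorem optimal_capacities_unique
    {I : Type*} [Fintype I] [Nonempty I]
    (l F a : I → ℝ) (Q : ℝ)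
    (hl : ∀ i, 0 < l i) (hF : ∀ i, 0 < F i) (ha : ∀ i, 0 < a i)
    (hQ : 0 < Q)
    (hdrop : ∑ i, l i * F i / a i ≤ Q)
    (hopt : ∑ i, l i * a i = (∑ i, l i * Real.sqrt (F i)) ^ 2 / Q) :
    ∀ i : I, a i = Real.sqrt (F i) * (∑ j, l j * Real.sqrt (F j)) / Q := by
  set S := ∑ j, l j * Real.sqrt (F j) with hS
  have hnonneg : ∀ i ∈ univ, 0 ≤ l i * (a i - S / Q * Real.sqrt (F i)) ^ 2 / a i := fun i _ =>
    div_nonneg (mul_nonneg (hl i).le (sq_nonneg _)) (ha i).le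
  have hexpand : ∑ i, l i * (a i - S / Q * Real.sqrt (F i)) ^ 2 / a i =
      ∑ i, l i * a i - 2 * (S / Q) * S + (S / Q) ^ 2 * ∑ i, l i * F i / a i := by
    rw [hS, mul_sum univ _ (2 * _), ← hS, mul_sum, ← sum_sub_distrib, ← sum_add_distrib]
    refine sum_congr rfl fun i _ => ?_
    have hai := (ha i).ne'
    have hsq := Real.sq_sqrt (hF i).le
    rw [← hsq, Real.sqrt_sq (Real.sqrt_nonneg _)]
    field_simp
    ring
  have hle : ∑ i, l i * (a i - S / Q * Real.sqrt (F i)) ^ 2 / a i ≤ 0 := by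
    have hbound := mul_le_mul_of_nonneg_left hdrop (sq_nonneg (S / Q))
    have hcancel : S ^ 2 / Q - 2 * (S / Q) * S + (S / Q) ^ 2 * Q = 0 := by
      field_simp
      ring
    rw [hexpand, hopt]
    linarith
  intro i
  have hterm := (sum_eq_zero_iff_of_nonneg hnonneg).1 (hle.antisymm (sum_nonneg hnonneg)) i
    (mem_univ i)
  have hdiff : a i - S / Q * Real.sqrt (F i) = 0 := by
    simpa [(hl i).ne', (ha i).ne'] using hterm
  rw [sub_eq_zero.1 hdiff]
  ring
end
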